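/- arXiv:1506.00945 — 3 statements merged into one kernel-verified Lean document; each statement's English description precedes it below -/
import Mathlib

section
/- In A_3^{ℤ/4}, one has ((1+y_1)(1+y_2)(1+y_3))^4 = 1 + 2([y_1,y_2] + [y_1,y_3] + [y_2,y_3]) + 2[[y_1,y_3],y_2], where [a,b] = ab − ba. -/
noncomputable section

/-- The monomial `y_{i₁} y_{i₂} ⋯ y_{i_t}` in the free (tensor) algebra over `ℤ/4`
associated to a list of indices. -/
def mono (n : ℕ) (l : List (Fin n)) : FreeAlgebra (ZMod 4) (Fin n) :=
  (l.map (FreeAlgebra.ι (ZMod 4))).prod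

/-- The defining relations of `A_n^{ℤ/4}`: every monomial in which some generator repeats
(i.e. the index list is not `Nodup`) is identified with `0`.  Taking `RingQuot` of this
relation is exactly the quotient of the free (tensor) algebra over `ℤ/4` by the two-sided
ideal generated by these monomials. -/
inductive ARel (n : ℕ) : FreeAlgebra (ZMod 4) (Fin n) → FreeAlgebra (ZMod 4) (Fin n) → Prop
  | rel (l : List (Fin n)) (h : ¬ l.Nodup) : ARel n (mono n l) 0

/-- The algebra `A_n^{ℤ/4}`. -/
abbrev A (n : ℕ) : Type := RingQuot (ARel n)

/-- The generators `y i` of `A_n^{ℤ/4}` (indexed by `Fin n`). -/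
def y (n : ℕ) (i : Fin n) : A n := RingQuot.mkRingHom (ARel n) (FreeAlgebra.ι (ZMod 4) i)

/-- The augmentation ideal `I`: the two-sided ideal generated by the generators `y i`. -/
def Iaug (n : ℕ) : TwoSidedIdeal (A n) := TwoSidedIdeal.span (Set.range (y n))

/-- The ring commutator `[a,b] = a*b - b*a`. -/
def rc {R : Type*} [Ring R] (a b : R) : R := a * b - b * a

/-- Monomials with a repeated generator vanish in `A n`. -/
theorem prod_y_eq_zero (n : ℕ) (l : List (Fin n)) (h : ¬ l.Nodup) :
    (l.map (y n)).prod = 0 := by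
  have := RingQuot.mkRingHom_rel (ARel.rel l h)
  rw [map_zero, mono, map_list_prod, List.map_map] at this
  exact this

theorem four_eq_zero_A (n : ℕ) : (4 : A n) = 0 := by
  have h : (4 : ZMod 4) = 0 := by decide
  have := congrArg (algebraMap (ZMod 4) (A n)) h
  rw [map_zero] at this
  exact (map_ofNat (algebraMap (ZMod 4) (A n)) 4).symm.trans this

theorem y2 (i : Fin 3) : y 3 i * y 3 i = 0 := by
  simpa using prod_y_eq_zero 3 [i, i] (by simp)

theorem y3 (i j : Fin 3) : y 3 i * (y 3 j * y 3 i) = 0 := by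
  simpa using prod_y_eq_zero 3 [i, j, i] (by simp)

theorem y4 (i j k : Fin 3) : y 3 i * (y 3 j * (y 3 k * y 3 i)) = 0 := by
  simpa using prod_y_eq_zero 3 [i, j, k, i] (by simp)

theorem y2z (i : Fin 3) (z : A 3) : y 3 i * (y 3 i * z) = 0 := by
  rw [← mul_assoc, y2, zero_mul]

theorem y3z (i j : Fin 3) (z : A 3) : y 3 i * (y 3 j * (y 3 i * z)) = 0 := by
  have := congrArg (· * z) (y3 i j)
  simpa [mul_assoc] using this

theorem y4z (i j k : Fin 3) (z : A 3) : y 3 i * (y 3 j * (y 3 k * (y 3 i * z))) = 0 := by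
  have := congrArg (· * z) (y4 i j k)
  simpa [mul_assoc] using this

/-- In `A_3^{ℤ/4}`,
`((1+y₁)(1+y₂)(1+y₃))⁴ = 1 + 2([y₁,y₂] + [y₁,y₃] + [y₂,y₃]) + 2[[y₁,y₃],y₂]`. -/
theorem stmt_5 :
    ((1 + y 3 0) * (1 + y 3 1) * (1 + y 3 2)) ^ 4 =
      1 + 2 * (rc (y 3 0) (y 3 1) + rc (y 3 0) (y 3 2) + rc (y 3 1) (y 3 2))
        + 2 * rc (rc (y 3 0) (y 3 2)) (y 3 1) := by
  have h4 := four_eq_zero_A 3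
  generalize hu : y 3 0 + y 3 1 + y 3 2 + y 3 0 * y 3 1 + y 3 0 * y 3 2 + y 3 1 * y 3 2
    + y 3 0 * (y 3 1 * y 3 2) = u
  have hx : (1 + y 3 0) * (1 + y 3 1) * (1 + y 3 2) = 1 + u := by
    rw [← hu]; noncomm_ring
  have huu : u * u = y 3 0 * y 3 1 + y 3 1 * y 3 0 + y 3 0 * y 3 2 + y 3 2 * y 3 0
      + y 3 1 * y 3 2 + y 3 2 * y 3 1 + 2 * (y 3 0 * (y 3 1 * y 3 2))
      + y 3 1 * (y 3 0 * y 3 2) + y 3 2 * (y 3 0 * y 3 1) + y 3 0 * (y 3 2 * y 3 1)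
      + y 3 1 * (y 3 2 * y 3 0) := by
    rw [← hu]
    simp only [mul_add, add_mul, mul_assoc, y2, y3, y4, y2z, y3z, y4z, add_zero, zero_add,
      mul_zero, two_mul]
    abel
  have hu4 : (u * u) * (u * u) = 0 := by
    rw [huu]
    simp only [mul_add, add_mul, mul_assoc, y2, y3, y4, y2z, y3z, y4z, add_zero, zero_add,
      mul_zero, two_mul]
  have e : (1 + u) ^ 4 = 1 + 2 * (u * u) + 4 * (u + u * u + u * u * u) + (u * u) * (u * u) := by
    noncomm_ring
  rw [hx, e, hu4, h4, zero_mul, huu, ← sub_eq_zero]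
  have key : ∀ w : A 3, w + w + (w + w) = 0 := fun w => by
    have : w + w + (w + w) = 4 * w := by noncomm_ring
    rw [this, h4, zero_mul]
  refine Eq.trans ?_ (key (y 3 1 * y 3 0 + y 3 2 * y 3 0 + y 3 2 * y 3 1
    + y 3 0 * (y 3 1 * y 3 2) + y 3 1 * (y 3 0 * y 3 2) + y 3 2 * (y 3 0 * y 3 1)))
  simp only [rc, two_mul, mul_sub, sub_mul, mul_add, add_mul, mul_assoc]
  abel
end
end

section
/- Let n ≥ 1 and let i_1, …, i_t (t ≥ 2) be any sequence of indices in {1,…,n}. Then in the unit group of A_n^{ℤ/4}, the left-normed iterated group commutator satisfies [[1+y_{i_1}, 1+y_{i_2}], …, 1+y_{i_t}] = 1 + [[y_{i_1}, y_{i_2}], …, y_{i_t}], where on the left [u,v] = u^{-1}v^{-1}uv is the group commutator of units and on the right [a,b] = ab − ba is the ring commutator. -/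
noncomputable section

/-- The group commutator `[a,b] = a⁻¹ b⁻¹ a b`. -/
def gcomm {G : Type*} [Group G] (a b : G) : G := a⁻¹ * b⁻¹ * a * b

lemma aux_mono_span (n : ℕ) (b : FreeAlgebra (ZMod 4) (Fin n)) :
    b ∈ Submodule.span (ZMod 4) (Set.range (mono n)) := by
  induction b using FreeAlgebra.induction with
  | grade0 r =>
    rw [Algebra.algebraMap_eq_smul_one]
    exact Submodule.smul_mem _ _ (Submodule.subset_span ⟨[], by simp [mono]⟩)
  | grade1 i => exact Submodule.subset_span ⟨[i], by simp [mono]⟩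
  | mul a b ha hb =>
    have h := Submodule.mul_mem_mul ha hb
    rw [Submodule.span_mul_span] at h
    refine Submodule.span_mono ?_ h
    rintro _ ⟨_, ⟨l, rfl⟩, _, ⟨m, rfl⟩, rfl⟩
    exact ⟨l ++ m, by simp [mono]⟩
  | add a b ha hb => exact Submodule.add_mem _ ha hb

lemma aux_y (n : ℕ) (i : Fin n) (a : A n) : y n i * a * y n i = 0 := by
  obtain ⟨b, rfl⟩ := RingQuot.mkRingHom_surjective (ARel n) a
  have hb := aux_mono_span n b
  unfold y
  induction hb using Submodule.span_induction with
  | mem x hx =>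
    obtain ⟨l, rfl⟩ := hx
    have h := RingQuot.mkRingHom_rel (ARel.rel (n := n) (i :: (l ++ [i])) (by simp))
    rw [map_zero] at h
    rw [← map_mul, ← map_mul, ← h]
    congr 1
    simp [mono, mul_assoc]
  | zero => simp
  | add x z _ _ hx hz => rw [map_add, mul_add, add_mul, hx, hz, add_zero]
  | smul c x _ hx =>
    rw [← map_mul, ← map_mul] at hx ⊢
    rw [mul_smul_comm, smul_mul_assoc, Algebra.smul_def, map_mul, hx, mul_zero]

lemma aux_rc {R : Type*} [Ring R] (x z : R) (hx : ∀ a, x * a * x = 0) (a : R) :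
    rc x z * a * rc x z = 0 := by
  have e : rc x z * a * rc x z = (x * (z * a) * x) * z - x * (z * a * z) * x
      - z * (x * a * x) * z + z * (x * (a * z) * x) := by
    unfold rc; noncomm_ring
  rw [e]; simp [hx]

lemma aux_inv {R : Type*} [Ring R] (g : Rˣ) (x : R) (hg : (g : R) = 1 + x)
    (hx : ∀ a, x * a * x = 0) : ((g⁻¹ : Rˣ) : R) = 1 - x := by
  have h1 : x * x = 0 := by simpa using hx 1
  rw [Units.inv_eq_of_mul_eq_one_right]
  rw [hg]
  have : (1 + x) * (1 - x) = 1 - x * x := by noncomm_ring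
  rw [this, h1, sub_zero]

lemma aux_gcomm {R : Type*} [Ring R] (g v : Rˣ) (x z : R) (hg : (g : R) = 1 + x)
    (hv : (v : R) = 1 + z) (hx : ∀ a, x * a * x = 0) (hz : ∀ a, z * a * z = 0) :
    ((gcomm g v : Rˣ) : R) = 1 + rc x z := by
  have h1 : x * x = 0 := by simpa using hx 1
  have h2 : z * z = 0 := by simpa using hz 1
  unfold gcomm rc
  rw [Units.val_mul, Units.val_mul, Units.val_mul, aux_inv g x hg hx, aux_inv v z hv hz, hg, hv]
  have e : (1 - x) * (1 - z) * (1 + x) * (1 + z) = 1 + (x * z - z * x) - z * z - z * x * z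
      - x * x - x * x * z + x * (z * z) + x * z * x + x * z * x * z := by noncomm_ring
  rw [e, h1, h2, hx, hz]; simp

lemma aux_fold (n : ℕ) (u : Fin n → (A n)ˣ) (hu : ∀ i, (u i : A n) = 1 + y n i)
    (rest : List (Fin n)) : ∀ (g : (A n)ˣ) (x : A n), (g : A n) = 1 + x →
    (∀ a, x * a * x = 0) →
    ((rest.foldl (fun acc j => gcomm acc (u j)) g : (A n)ˣ) : A n)
      = 1 + rest.foldl (fun acc j => rc acc (y n j)) x := by
  induction rest with
  | nil => intro g x hg _; simpa using hg
  | cons j l ih =>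
    intro g x hg hx
    exact ih _ _ (aux_gcomm g (u j) x _ hg (hu j) hx (aux_y n j)) (aux_rc x _ hx)

/-- For any sequence of indices `i₁, i₂, …, i_t` (t ≥ 2), the left-normed iterated group
commutator of the units `1 + y_{i_k}` in `(A_n^{ℤ/4})ˣ` equals `1` plus the corresponding
left-normed iterated ring commutator of the `y_{i_k}`. -/
theorem stmt_10 (n : ℕ) (hn : 1 ≤ n) (i₁ i₂ : Fin n) (rest : List (Fin n))
    (u : Fin n → (A n)ˣ) (hu : ∀ i, (u i : A n) = 1 + y n i) :
    ((rest.foldl (fun acc j => gcomm acc (u j)) (gcomm (u i₁) (u i₂)) : (A n)ˣ) : A n)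
      = 1 + rest.foldl (fun acc j => rc acc (y n j)) (rc (y n i₁) (y n i₂)) := by
  exact aux_fold n u hu rest _ _
    (aux_gcomm _ _ _ _ (hu i₁) (hu i₂) (aux_y n i₁) (aux_y n i₂)) (aux_rc _ _ (aux_y n i₁))
end
end

section
/- In the group K_3^{ℤ/4}, the element α_3 = x_1x_2x_3 satisfies α_3^4 = ([x_1,x_2]^2 [x_1,x_3]^2 [x_2,x_3]^2) · [[x_1,x_3],x_2]^2, where [a,b] = a^{-1}b^{-1}ab. -/
noncomputable section

/-- The defining relators of the Cohen group `K_n^{ℤ/4}`: left-normed iterated group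
commutators `[[x_{i₁}, x_{i₂}], …, x_{i_t}]` (t ≥ 2) in which some index repeats, together
with the fourth powers `x_i⁴` of the generators. -/
def relsK (n : ℕ) : Set (FreeGroup (Fin n)) :=
  {w | ∃ (i₁ i₂ : Fin n) (rest : List (Fin n)), ¬ (i₁ :: i₂ :: rest).Nodup ∧
        w = rest.foldl (fun acc j => gcomm acc (FreeGroup.of j))
              (gcomm (FreeGroup.of i₁) (FreeGroup.of i₂))}
  ∪ {w | ∃ i : Fin n, w = (FreeGroup.of i) ^ 4}

/-- The Cohen group `K_n^{ℤ/4}`, presented by generators `x_1, …, x_n` and the above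
relators. -/
abbrev K (n : ℕ) : Type := PresentedGroup (relsK n)

/-- The generators `x i` of `K_n^{ℤ/4}` (indexed by `Fin n`). -/
def x (n : ℕ) (i : Fin n) : K n := PresentedGroup.of i

set_option linter.unusedSimpArgs false

theorem gcomm_swap {G : Type*} [Group G] (s t : G) : s * t = t * (s * gcomm s t) := by
  simp [gcomm, mul_assoc]

theorem gcomm_one_comm {G : Type*} [Group G] {s t : G} (h : gcomm s t = 1) :
    s * t = t * s := by
  have := gcomm_swap s t
  rwa [h, mul_one] at this

theorem gcomm_inv {G : Type*} [Group G] (s t : G) : (gcomm s t)⁻¹ = gcomm t s := by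
  simp [gcomm, mul_assoc]

theorem assoc_of {G : Type*} [Group G] {s t r : G} (h : s * t = r) (z : G) :
    s * (t * z) = r * z := by rw [← h, mul_assoc]

/-- Push a power of `s` to the left when `t s = s t z` with `z` commuting with `s` and `t`. -/
theorem pow_four_of {G : Type*} [Group G] {s t z : G} (h : t * s = s * (t * z))
    (hs : z * s = s * z) (h4 : s ^ 4 = 1) : z ^ 4 = 1 := by
  have hs' := fun y => assoc_of hs y
  have h' := fun y => assoc_of h y
  have : t * s ^ 4 = s ^ 4 * (t * z ^ 4) := by
    simp only [pow_succ, pow_zero, one_mul, mul_assoc, h, h', hs, hs']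
  rw [h4, mul_one, one_mul] at this
  exact (mul_eq_left.mp this.symm)

theorem collect {G : Type*} [Group G] {a b c U V W P Q R : G}
    (a4 : a ^ 4 = 1) (b4 : b ^ 4 = 1) (c4 : c ^ 4 = 1)
    (ba : b * a = a * (b * U)) (ca : c * a = a * (c * V)) (cb : c * b = b * (c * W))
    (Ua : U * a = a * U) (Ub : U * b = b * U) (Uc : U * c = c * (U * Q))
    (Va : V * a = a * V) (Vc : V * c = c * V) (Vb : V * b = b * (V * P))
    (Wb : W * b = b * W) (Wc : W * c = c * W) (Wa : W * a = a * (W * R))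
    (Pz : ∀ y, P * y = y * P) (Qz : ∀ y, Q * y = y * Q) (Rz : ∀ y, R * y = y * R) :
    (a * b * c) ^ 4 = U ^ 2 * V ^ 2 * W ^ 2 * P ^ 2 ∧ V * U = U * V ∧ W * V = V * W ∧
      W * U = U * W ∧ U ^ 4 = 1 ∧ V ^ 4 = 1 ∧ W ^ 4 = 1 ∧ P ^ 4 = 1 := by
  have U4 : U ^ 4 = 1 := pow_four_of ba Ua a4
  have V4 : V ^ 4 = 1 := pow_four_of ca Va a4
  have W4 : W ^ 4 = 1 := pow_four_of cb Wb b4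
  have P4 : P ^ 4 = 1 := pow_four_of Vb (Pz _) b4
  have Q4 : Q ^ 4 = 1 := pow_four_of Uc (Qz _) c4
  have R4 : R ^ 4 = 1 := pow_four_of Wa (Rz _) a4
  have ba' := fun y => assoc_of ba y
  have ca' := fun y => assoc_of ca y
  have cb' := fun y => assoc_of cb y
  have Ua' := fun y => assoc_of Ua y
  have Ub' := fun y => assoc_of Ub y
  have Uc' := fun y => assoc_of Uc y
  have Va' := fun y => assoc_of Va y
  have Vc' := fun y => assoc_of Vc y
  have Vb' := fun y => assoc_of Vb y
  have Wb' := fun y => assoc_of Wb y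
  have Wc' := fun y => assoc_of Wc y
  have Wa' := fun y => assoc_of Wa y
  have Pa := Pz a
  have Pa' := fun y => assoc_of Pa y
  have Pb := Pz b
  have Pb' := fun y => assoc_of Pb y
  have Pc := Pz c
  have Pc' := fun y => assoc_of Pc y
  have PU := Pz U
  have PU' := fun y => assoc_of PU y
  have PV := Pz V
  have PV' := fun y => assoc_of PV y
  have PW := Pz W
  have PW' := fun y => assoc_of PW y
  have Qa := Qz a
  have Qa' := fun y => assoc_of Qa y
  have Qb := Qz b
  have Qb' := fun y => assoc_of Qb y
  have Qc := Qz c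
  have Qc' := fun y => assoc_of Qc y
  have QU := Qz U
  have QU' := fun y => assoc_of QU y
  have QV := Qz V
  have QV' := fun y => assoc_of QV y
  have QW := Qz W
  have QW' := fun y => assoc_of QW y
  have QP := Qz P
  have QP' := fun y => assoc_of QP y
  have Ra := Rz a
  have Ra' := fun y => assoc_of Ra y
  have Rb := Rz b
  have Rb' := fun y => assoc_of Rb y
  have Rc := Rz c
  have Rc' := fun y => assoc_of Rc y
  have RU := Rz U
  have RU' := fun y => assoc_of RU y
  have RV := Rz V
  have RV' := fun y => assoc_of RV y
  have RW := Rz W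
  have RW' := fun y => assoc_of RW y
  have RP := Rz P
  have RP' := fun y => assoc_of RP y
  have RQ := Rz Q
  have RQ' := fun y => assoc_of RQ y
  have VU : V * U = U * V := by
    have h : b * (V * P) * a = V * (a * (b * U)) := by rw [← Vb, mul_assoc, ba]
    simp only [mul_assoc, ba, ca, cb, Ua, Ub, Uc, Va, Vc, Vb, Wb, Wc, Wa, ba', ca', cb', Ua', Ub', Uc', Va', Vc', Vb', Wb', Wc', Wa', Pa, Pa', Pb, Pb', Pc, Pc', PU, PU', PV, PV', PW, PW', Qa, Qa', Qb, Qb', Qc, Qc', QU, QU', QV, QV', QW, QW', QP, QP', Ra, Ra', Rb, Rb', Rc, Rc', RU, RU', RV, RV', RW, RW', RP, RP', RQ, RQ', mul_right_inj] at h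
    simp only [← mul_assoc, mul_left_inj] at h
    exact h.symm
  have WU : W * U = U * W := by
    have h : b * W * a = W * (a * (b * U)) := by rw [← Wb, mul_assoc, ba]
    simp only [mul_assoc, ba, ca, cb, Ua, Ub, Uc, Va, Vc, Vb, Wb, Wc, Wa, ba', ca', cb', Ua', Ub', Uc', Va', Vc', Vb', Wb', Wc', Wa', Pa, Pa', Pb, Pb', Pc, Pc', PU, PU', PV, PV', PW, PW', Qa, Qa', Qb, Qb', Qc, Qc', QU, QU', QV, QV', QW, QW', QP, QP', Ra, Ra', Rb, Rb', Rc, Rc', RU, RU', RV, RV', RW, RW', RP, RP', RQ, RQ', mul_right_inj] at h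
    simp only [← mul_assoc, mul_left_inj] at h
    exact h.symm
  have WV : W * V = V * W := by
    have h : c * W * a = W * (a * (c * V)) := by rw [← Wc, mul_assoc, ca]
    simp only [mul_assoc, ba, ca, cb, Ua, Ub, Uc, Va, Vc, Vb, Wb, Wc, Wa, ba', ca', cb', Ua', Ub', Uc', Va', Vc', Vb', Wb', Wc', Wa', Pa, Pa', Pb, Pb', Pc, Pc', PU, PU', PV, PV', PW, PW', Qa, Qa', Qb, Qb', Qc, Qc', QU, QU', QV, QV', QW, QW', QP, QP', Ra, Ra', Rb, Rb', Rc, Rc', RU, RU', RV, RV', RW, RW', RP, RP', RQ, RQ', mul_right_inj] at h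
    simp only [← mul_assoc, mul_left_inj] at h
    exact h.symm
  have VU' := fun y => assoc_of VU y
  have WU' := fun y => assoc_of WU y
  have WV' := fun y => assoc_of WV y
  have HW : P = Q * R := by
    have h : c * (b * a) = b * (c * W) * a := by rw [← cb, mul_assoc]
    rw [ba] at h
    simp only [mul_assoc, ba, ca, cb, Ua, Ub, Uc, Va, Vc, Vb, Wb, Wc, Wa, ba', ca', cb', Ua', Ub', Uc', Va', Vc', Vb', Wb', Wc', Wa', Pa, Pa', Pb, Pb', Pc, Pc', PU, PU', PV, PV', PW, PW', Qa, Qa', Qb, Qb', Qc, Qc', QU, QU', QV, QV', QW, QW', QP, QP', Ra, Ra', Rb, Rb', Rc, Rc', RU, RU', RV, RV', RW, RW', RP, RP', RQ, RQ', VU, VU', WU, WU', WV, WV', mul_right_inj] at h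
    exact h
  have key : (a * b * c) ^ 4 = a ^ 4 * b ^ 4 * c ^ 4 * U ^ 6 * V ^ 6 * W ^ 6 * P ^ 10 * Q ^ 24 * R ^ 4 := by
    simp only [pow_succ, pow_zero, one_mul, mul_assoc, ba, ca, cb, Ua, Ub, Uc, Va, Vc, Vb, Wb, Wc, Wa, ba', ca', cb', Ua', Ub', Uc', Va', Vc', Vb', Wb', Wc', Wa', Pa, Pa', Pb, Pb', Pc, Pc', PU, PU', PV, PV', PW, PW', Qa, Qa', Qb, Qb', Qc, Qc', QU, QU', QV, QV', QW, QW', QP, QP', Ra, Ra', Rb, Rb', Rc, Rc', RU, RU', RV, RV', RW, RW', RP, RP', RQ, RQ', VU, VU', WU, WU', WV, WV', mul_right_inj]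
  refine ⟨?_, VU, WV, WU, U4, V4, W4, P4⟩
  have red : ∀ z : G, z ^ 4 = 1 → z ^ 6 = z ^ 2 ∧ z ^ 10 = z ^ 2 ∧ z ^ 24 = 1 := by
    intro z hz
    refine ⟨?_, ?_, ?_⟩
    · rw [show 6 = 4 + 2 from rfl, pow_add, hz, one_mul]
    · rw [show 10 = 4 * 2 + 2 from rfl, pow_add, pow_mul, hz, one_pow, one_mul]
    · rw [show 24 = 4 * 6 from rfl, pow_mul, hz, one_pow]
  rw [key, a4, b4, c4, R4, (red U U4).1, (red V V4).1, (red W W4).1, (red P P4).2.1,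
    (red Q Q4).2.2]
  simp only [one_mul, mul_one]

theorem relK {n : ℕ} (i j : Fin n) (rest : List (Fin n)) (h : ¬ (i :: j :: rest).Nodup) :
    rest.foldl (fun acc k => gcomm acc (x n k)) (gcomm (x n i) (x n j)) = 1 := by
  have h1 : ∀ (l : List (Fin n)) (w : FreeGroup (Fin n)),
      PresentedGroup.mk (relsK n) (l.foldl (fun acc k => gcomm acc (FreeGroup.of k)) w) =
        l.foldl (fun acc k => gcomm acc (x n k)) (PresentedGroup.mk (relsK n) w) := by
    intro l
    induction l with
    | nil => intro w; rfl
    | cons k l ih => intro w; simp only [List.foldl_cons]; rw [ih]; rfl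
  have h2 := PresentedGroup.one_of_mem (rels := relsK n) (Or.inl ⟨i, j, rest, h, rfl⟩)
  rw [h1] at h2
  exact h2

theorem powK {n : ℕ} (i : Fin n) : x n i ^ 4 = 1 :=
  PresentedGroup.one_of_mem (rels := relsK n) (Or.inr ⟨i, rfl⟩)

theorem centK (z : K 3) (h : ∀ i, gcomm z (x 3 i) = 1) (y : K 3) : z * y = y * z := by
  have hy : y ∈ Subgroup.centralizer {z} := by
    have : (⊤ : Subgroup (K 3)) ≤ Subgroup.centralizer {z} := by
      rw [← PresentedGroup.closure_range_of (relsK 3), Subgroup.closure_le]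
      rintro _ ⟨i, rfl⟩
      simp only [SetLike.mem_coe, Subgroup.mem_centralizer_singleton_iff]
      exact (gcomm_one_comm (h i)).symm
    exact this trivial
  exact (Subgroup.mem_centralizer_singleton_iff.mp hy).symm

/-- In `K_3^{ℤ/4}`, the element `α₃ = x₁x₂x₃` satisfies
`α₃⁴ = ([x₁,x₂]²[x₁,x₃]²[x₂,x₃]²)·[[x₁,x₃],x₂]²`. -/
theorem stmt_13 :
    (x 3 0 * x 3 1 * x 3 2) ^ 4 =
      (gcomm (x 3 0) (x 3 1)) ^ 2 * (gcomm (x 3 0) (x 3 2)) ^ 2 *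
        (gcomm (x 3 1) (x 3 2)) ^ 2 * (gcomm (gcomm (x 3 0) (x 3 2)) (x 3 1)) ^ 2 := by
  have triple : ∀ i j : Fin 3, gcomm (gcomm (x 3 i) (x 3 j)) (x 3 i) = 1 ∧
      gcomm (gcomm (x 3 i) (x 3 j)) (x 3 j) = 1 := fun i j =>
    ⟨relK i j [i] (by simp), relK i j [j] (by simp)⟩
  have quad : ∀ i j k l : Fin 3,
      gcomm (gcomm (gcomm (x 3 i) (x 3 j)) (x 3 k)) (x 3 l) = 1 := fun i j k l =>
    relK i j [k, l] (fun h => by simpa using h.length_le_card)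
  obtain ⟨h, VU, WV, WU, U4, V4, W4, P4⟩ := collect (powK 0) (powK 1) (powK (n := 3) 2)
    (gcomm_swap _ _) (gcomm_swap _ _) (gcomm_swap _ _)
    (gcomm_one_comm (triple 1 0).2) (gcomm_one_comm (triple 1 0).1) (gcomm_swap _ _)
    (gcomm_one_comm (triple 2 0).2) (gcomm_one_comm (triple 2 0).1) (gcomm_swap _ _)
    (gcomm_one_comm (triple 2 1).2) (gcomm_one_comm (triple 2 1).1) (gcomm_swap _ _)
    (centK _ (quad 2 0 1)) (centK _ (quad 1 0 2)) (centK _ (quad 2 1 0))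
  have sq : ∀ z : K 3, z ^ 4 = 1 → z⁻¹ ^ 2 = z ^ 2 := by
    intro z hz
    rw [inv_pow, inv_eq_iff_mul_eq_one, ← pow_add]
    exact hz
  have hP : gcomm (gcomm (x 3 0) (x 3 2)) (x 3 1) =
      (gcomm (gcomm (x 3 2) (x 3 0)) (x 3 1))⁻¹ := by
    have hc := centK _ (quad 2 0 1) (gcomm (x 3 2) (x 3 0))
    have e : gcomm (gcomm (x 3 2) (x 3 0))⁻¹ (x 3 1) =
        gcomm (x 3 2) (x 3 0) * (gcomm (gcomm (x 3 2) (x 3 0)) (x 3 1))⁻¹ *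
          (gcomm (x 3 2) (x 3 0))⁻¹ := by
      generalize gcomm (x 3 2) (x 3 0) = v
      simp [gcomm, mul_assoc]
    rw [← gcomm_inv (x 3 2) (x 3 0), e, mul_inv_eq_iff_eq_mul]
    rw [eq_inv_mul_iff_mul_eq, ← mul_assoc, hc, mul_inv_cancel_right]
  rw [h, hP, sq _ P4, ← gcomm_inv (x 3 1) (x 3 0), ← gcomm_inv (x 3 2) (x 3 0),
    ← gcomm_inv (x 3 2) (x 3 1), sq _ U4, sq _ V4, sq _ W4]
end
end
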